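/- The diameter of the 1-skeleton of PSB(n) is at most 4: between any two vertices v(x), v(y) of PSB(n) there is a path of at most 4 edges, obtained via x — x̂ — (all-ascending tour) — ŷ — y, where x̂, ŷ are the pyramidal tours whose descending cities are exactly the step-back cities of x, y respectively. -/

import Mathlib

/-- A Hamiltonian tour on the cities `{1,…,n}` (represented as `Fin n`,
city `c` corresponding to the element `c-1`): a permutation acting cyclically on all cities. -/
def IsTour {n : ℕ} (τ : Equiv.Perm (Fin n)) : Prop :=
  ∀ i j : Fin n, ∃ k : ℕ, (τ ^ k) i = j

/-- `i` is a peak of the tour `τ`. -/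
def IsPeak {n : ℕ} (τ : Equiv.Perm (Fin n)) (i : Fin n) : Prop :=
  τ⁻¹ i < i ∧ τ i < i

/-- `i` is a step-back peak of `τ`: either `τ⁻¹ i < i`, `τ i = i - 1`, `τ² i > i`
(ascending step-back) or `τ⁻² i > i`, `τ⁻¹ i = i - 1`, `τ i < i` (descending step-back). -/
def IsStepBackPeak {n : ℕ} (τ : Equiv.Perm (Fin n)) (i : Fin n) : Prop :=
  (τ⁻¹ i < i ∧ ((τ i : ℕ) + 1 = (i : ℕ)) ∧ i < τ (τ i)) ∨
  (i < τ⁻¹ (τ⁻¹ i) ∧ ((τ⁻¹ i : ℕ) + 1 = (i : ℕ)) ∧ τ i < i)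

/-- A pyramidal tour: a Hamiltonian tour whose unique peak is the last city `n`. -/
def IsPyramidal {n : ℕ} (τ : Equiv.Perm (Fin n)) : Prop :=
  IsTour τ ∧ ∀ i : Fin n, IsPeak τ i ↔ (i : ℕ) = n - 1

/-- A pyramidal tour with step-backs: a Hamiltonian tour with exactly one proper peak
(a peak that is not a step-back peak), namely the last city `n`. -/
def IsPSB {n : ℕ} (τ : Equiv.Perm (Fin n)) : Prop :=
  IsTour τ ∧ ∀ i : Fin n, (IsPeak τ i ∧ ¬ IsStepBackPeak τ i) ↔ (i : ℕ) = n - 1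

/-- City `i` is visited by `τ` in ascending order (taking step-backs into account):
either the successor of `i` is larger and `i` is not the lower city of a descending
step-back, or `i` is an ascending step-back peak. -/
def Ascends {n : ℕ} (τ : Equiv.Perm (Fin n)) (i : Fin n) : Prop :=
  (i < τ i ∧ ¬ (((i : ℕ) + 1 = (τ i : ℕ)) ∧ τ (τ i) < τ i ∧ τ i < τ⁻¹ i)) ∨
  (τ⁻¹ i < i ∧ ((τ i : ℕ) + 1 = (i : ℕ)) ∧ i < τ (τ i))

/-- The city represented by the element of `Fin n` with value `m` is visited ascending. -/
def AscAt {n : ℕ} (τ : Equiv.Perm (Fin n)) (m : ℕ) : Prop :=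
  ∃ i : Fin n, (i : ℕ) = m ∧ Ascends τ i

/-- The city represented by the element of `Fin n` with value `m` is a step-back peak. -/
def SBPeakAt {n : ℕ} (τ : Equiv.Perm (Fin n)) (m : ℕ) : Prop :=
  ∃ i : Fin n, (i : ℕ) = m ∧ IsStepBackPeak τ i

/-- The pyramidal encodings of `x` and `y` have the same value at coordinate `m`. -/
def SameEnc {n : ℕ} (x y : Equiv.Perm (Fin n)) (m : ℕ) : Prop :=
  (AscAt x m ↔ AscAt y m) ∧ (SBPeakAt x m ↔ SBPeakAt y m)

/-- The pyramidal encodings of `x` and `y` agree on the pair of neighboring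
coordinates `(k, k+1)`, including the step-back marks overlapping the pair. -/
def SamePair {n : ℕ} (x y : Equiv.Perm (Fin n)) (k : ℕ) : Prop :=
  SameEnc x y k ∧ SameEnc x y (k + 1) ∧ (SBPeakAt x (k + 2) ↔ SBPeakAt y (k + 2))

/-- Characteristic vector of a tour, in `ℝ^E` with `E = Fin n × Fin n`. -/
def chv {n : ℕ} (τ : Equiv.Perm (Fin n)) : Fin n × Fin n → ℝ :=
  fun e => if τ e.1 = e.2 then 1 else 0

/-- The vertices of the polytope `PSB(n)`: characteristic vectors of all
pyramidal tours with step-backs. -/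
def PSBvertices (n : ℕ) : Set (Fin n × Fin n → ℝ) :=
  chv '' {τ : Equiv.Perm (Fin n) | IsPSB τ}

/-- `u` and `w` are adjacent vertices in the 1-skeleton of the polytope `conv S`:
the segment `[u,w]` is a one-dimensional face (an extreme subset) of the polytope. -/
def AdjacentIn {n : ℕ} (S : Set (Fin n × Fin n → ℝ)) (u w : Fin n × Fin n → ℝ) : Prop :=
  u ≠ w ∧ IsExtreme ℝ (convexHull ℝ S) (segment ℝ u w)

theorem tour_closed {n : ℕ} {z : Equiv.Perm (Fin n)} (hz : IsTour z) (S : Fin n → Prop)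
    (i : Fin n) (hi : S i) (hS : ∀ k, S k → S (z k)) (j : Fin n) : S j := by
  obtain ⟨k, rfl⟩ := hz i j
  induction k with
  | zero => simpa using hi
  | succ k ih => rw [pow_succ']; exact hS _ ih

theorem tour_ne {n : ℕ} (hn : 3 ≤ n) {z : Equiv.Perm (Fin n)} (hz : IsTour z) (i : Fin n) :
    z i ≠ i := by
  intro h
  have h0 := tour_closed hz (fun k => k = i) i rfl (by rintro k rfl; exact h)
  have a := h0 ⟨0, by omega⟩
  have b := h0 ⟨1, by omega⟩
  rw [← b] at a
  simp at a

theorem tour_ne2 {n : ℕ} (hn : 3 ≤ n) {z : Equiv.Perm (Fin n)} (hz : IsTour z) (i : Fin n) :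
    z (z i) ≠ i := by
  intro h
  have h0 := tour_closed hz (fun k => k = i ∨ k = z i) i (Or.inl rfl)
    (by rintro k (rfl | rfl) <;> simp [h])
  have a := h0 ⟨0, by omega⟩
  have b := h0 ⟨1, by omega⟩
  have c := h0 ⟨2, by omega⟩
  simp only [Fin.ext_iff] at a b c
  omega

theorem tour_conj {n : ℕ} {z s : Equiv.Perm (Fin n)} (hz : IsTour z) (hs : s * s = 1) :
    IsTour (s * z * s) := by
  have hinv : s⁻¹ = s := by rw [inv_eq_iff_mul_eq_one]; exact hs
  intro i j
  obtain ⟨k, hk⟩ := hz (s i) (s j)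
  refine ⟨k, ?_⟩
  have : (s * z * s) = s * z * s⁻¹ := by rw [hinv]
  rw [this, conj_pow, hinv]
  simp only [Equiv.Perm.mul_apply, hk]
  rw [← Equiv.Perm.mul_apply, hs]; rfl

theorem tour_inv {n : ℕ} {z : Equiv.Perm (Fin n)} (hz : IsTour z) : IsTour z⁻¹ := by
  intro i j
  obtain ⟨k, hk⟩ := hz j i
  refine ⟨k, ?_⟩
  rw [inv_pow, Equiv.Perm.inv_eq_iff_eq]; exact hk.symm

theorem rot_val {n : ℕ} (i : Fin n) :
    (finRotate n i : ℕ) = if (i : ℕ) + 1 = n then 0 else (i : ℕ) + 1 := by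
  cases n with
  | zero => exact i.elim0
  | succ m =>
    rw [finRotate_apply, Fin.val_add_one]
    simp [Fin.ext_iff]

theorem rot_tour {n : ℕ} (hn : 3 ≤ n) : IsTour (finRotate n) := by
  obtain ⟨m, rfl⟩ : ∃ m, n = m + 2 := ⟨n - 2, by omega⟩
  have hne : ∀ i, finRotate (m + 2) i ≠ i := by
    intro i h
    have := rot_val i
    rw [h] at this
    split_ifs at this <;> omega
  intro i j
  exact isCycle_finRotate.exists_pow_eq (hne i) (hne j)

/-- Tours sharing the edges of `x ∪ y` only being `x`, `y` implies adjacency. -/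
theorem adj_of {n : ℕ} {x y : Equiv.Perm (Fin n)} (hx : IsPSB x) (hy : IsPSB y)
    (h : ∀ z : Equiv.Perm (Fin n), IsTour z → (∀ i, z i = x i ∨ z i = y i) → z = x ∨ z = y) :
    chv x = chv y ∨ AdjacentIn (PSBvertices n) (chv x) (chv y) := by
  classical
  by_cases hxy : chv x = chv y
  · exact Or.inl hxy
  right
  refine ⟨hxy, ?_⟩
  let L : (Fin n × Fin n → ℝ) → ℝ := fun v =>
    ∑ e : Fin n × Fin n, (if x e.1 = e.2 ∨ y e.1 = e.2 then 0 else v e)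
  have Llin : ∀ (a b : ℝ) v w, L (a • v + b • w) = a * L v + b * L w := by
    intro a b v w
    simp only [L, Finset.mul_sum, ← Finset.sum_add_distrib]
    refine Finset.sum_congr rfl fun e _ => ?_
    split_ifs <;> simp
  have Lx : L (chv x) = 0 := by
    refine Finset.sum_eq_zero fun e _ => ?_
    unfold chv
    split_ifs <;> simp_all
  have Ly : L (chv y) = 0 := by
    refine Finset.sum_eq_zero fun e _ => ?_
    unfold chv
    split_ifs <;> simp_all
  have Lseg : ∀ v ∈ segment ℝ (chv x) (chv y), L v = 0 := by
    rintro v ⟨a, b, -, -, -, rfl⟩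
    rw [Llin, Lx, Ly]; simp
  have hull : convexHull ℝ (PSBvertices n) ⊆
      {v | 0 ≤ L v ∧ (L v = 0 → v ∈ segment ℝ (chv x) (chv y))} := by
    apply convexHull_min
    · rintro _ ⟨z, hz, rfl⟩
      have hnn : ∀ e : Fin n × Fin n,
          0 ≤ (if x e.1 = e.2 ∨ y e.1 = e.2 then 0 else chv z e) := by
        intro e; unfold chv; split_ifs <;> simp
      refine ⟨Finset.sum_nonneg fun e _ => hnn e, fun h0 => ?_⟩
      have h1 := (Finset.sum_eq_zero_iff_of_nonneg (fun e _ => hnn e)).1 h0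
      have h2 : ∀ i, z i = x i ∨ z i = y i := by
        intro i
        have := h1 (i, z i) (Finset.mem_univ _)
        simp only [chv, if_true] at this
        by_contra hc
        push Not at hc
        rw [if_neg (by simp only [not_or]; exact ⟨hc.1.symm, hc.2.symm⟩)] at this
        exact one_ne_zero this
      rcases h z hz.1 h2 with rfl | rfl
      · exact left_mem_segment ℝ _ _
      · exact right_mem_segment ℝ _ _
    · rintro v ⟨hv, hv'⟩ w ⟨hw, hw'⟩ a b ha hb hab
      refine ⟨by rw [Llin]; positivity, fun h0 => ?_⟩
      rw [Llin] at h0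
      have e1 : a * L v = 0 := by nlinarith [mul_nonneg ha hv, mul_nonneg hb hw]
      have e2 : b * L w = 0 := by nlinarith [mul_nonneg ha hv, mul_nonneg hb hw]
      rcases eq_or_lt_of_le ha with ha0 | ha0
      · subst ha0
        obtain rfl : b = 1 := by linarith
        simpa using hw' (by simpa using e2)
      rcases eq_or_lt_of_le hb with hb0 | hb0
      · subst hb0
        obtain rfl : a = 1 := by linarith
        simpa using hv' (by simpa using e1)
      exact convex_segment _ _ (hv' (by simpa [ha0.ne'] using e1))
        (hw' (by simpa [hb0.ne'] using e2)) ha hb hab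
  have hxm : chv x ∈ PSBvertices n := ⟨x, hx, rfl⟩
  have hym : chv y ∈ PSBvertices n := ⟨y, hy, rfl⟩
  refine ⟨(convex_convexHull ℝ _).segment_subset (subset_convexHull ℝ _ hxm)
    (subset_convexHull ℝ _ hym), ?_⟩
  rintro v hv w hw u hu ⟨a, b, ha, hb, hab, rfl⟩
  have h0 := Lseg _ hu
  rw [Llin] at h0
  have pv := (hull hv).1
  have pw := (hull hw).1
  have e1 : a * L v = 0 := by nlinarith [mul_nonneg ha.le pv, mul_nonneg hb.le pw]
  exact (hull hv).2 (by simpa [ha.ne'] using e1)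

/-! ### Tours with the unique valley `0` -/

def OneValley {n : ℕ} (π : Equiv.Perm (Fin n)) : Prop :=
  ∀ h : Fin n, π h < h → π h < π (π h) → (π h : ℕ) = 0

theorem claimA {n : ℕ} {π : Equiv.Perm (Fin n)} (hv : OneValley π) (N : ℕ) :
    ∀ b : Fin n, (π b : ℕ) = N → b < π b → ∀ a, a < π a → a < π b → π a ≤ π b := by
  induction N using Nat.strong_induction_on with
  | _ N ih =>
  intro b hN hb a ha hab
  rcases lt_trichotomy a b with h | h | h
  · obtain ⟨b', rfl⟩ := π.surjective b
    have hb' : b' < π b' := by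
      by_contra hc
      rcases eq_or_lt_of_le (not_lt.1 hc) with e | e
      · rw [e] at hb; simp [e] at hb
      · have := hv b' e hb
        have := Fin.lt_def.1 h
        omega
    have := ih _ (by rw [← hN]; exact hb) b' rfl hb' a ha h
    exact this.trans hb.le
  · rw [h]
  · obtain ⟨a', rfl⟩ := π.surjective a
    have ha' : a' < π a' := by
      by_contra hc
      rcases eq_or_lt_of_le (not_lt.1 hc) with e | e
      · rw [e] at ha; simp [e] at ha
      · have := hv a' e ha
        have := Fin.lt_def.1 h
        omega
    have := ih _ (by rw [← hN]; exact hab) a' rfl ha' b hb h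
    exact absurd hab (not_lt.2 this)

theorem oneValley_inv {n : ℕ} {π : Equiv.Perm (Fin n)} (hv : OneValley π) : OneValley π⁻¹ := by
  intro h h1 h2
  obtain ⟨k, rfl⟩ := π.surjective h
  obtain ⟨l, rfl⟩ := π.surjective k
  simp at h1 h2 ⊢
  exact hv l h2 h1

theorem claimB {n : ℕ} {π : Equiv.Perm (Fin n)} (hv : OneValley π) (c d : Fin n)
    (hc : π c < c) (hd : π d < d) (h : π d < c) : d ≤ c := by
  have := claimA (oneValley_inv hv) _ (π c) rfl (by simpa using hc) (π d) (by simpa using hd)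
    (by simpa using h)
  simpa using this

theorem onePeak {n : ℕ} {π : Equiv.Perm (Fin n)} (ht : IsTour π) (hv : OneValley π)
    (b : Fin n) (h1 : b < π b) (h2 : π (π b) < π b) : (π b : ℕ) + 1 = n := by
  by_contra hc
  have hlt := (π b).isLt
  have := tour_closed ht (fun k => k ≤ π b) (π b) le_rfl (by
    intro k hk
    rcases lt_or_ge k (π k) with h | h
    · rcases eq_or_lt_of_le hk with e | e
      · rw [e]; exact h2.le
      · exact claimA hv _ b rfl h1 k h e
    · exact h.trans hk) ⟨n - 1, by omega⟩
  have := Fin.le_def.1 this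
  simp at this
  omega

theorem core {n : ℕ} (hn : 3 ≤ n) {π z : Equiv.Perm (Fin n)} (ht : IsTour π)
    (hv : OneValley π) (hz : IsTour z) (hs : ∀ i, z i = π i ∨ z i = finRotate n i) :
    z = π ∨ z = finRotate n := by
  have star : ∀ j, π j < j → z j = π j → (π j : ℕ) ≠ 0 →
      π (π j) < π j ∧ z (π j) = π (π j) := by
    intro j hj hzj h0
    have hd : π (π j) < π j := by
      rcases lt_trichotomy (π (π j)) (π j) with h | h | h
      · exact h
      · exact absurd h (tour_ne hn ht _)
      · exact absurd (hv j hj h) h0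
    refine ⟨hd, ?_⟩
    by_contra hne
    have hz1 := (hs (π j)).resolve_left hne
    have hr := rot_val (π j)
    have hjl := j.isLt
    have hj' := Fin.lt_def.1 hj
    rw [if_neg (by omega), ← hz1] at hr
    have hne2 : (π j : ℕ) + 1 ≠ j := by
      intro e
      have : z (z j) = j := by rw [hzj]; exact Fin.ext (by omega)
      exact tour_ne2 hn hz _ this
    -- the city after `π j`
    obtain ⟨b, hb⟩ := π.surjective (z (π j))
    have hup : π b < π (π b) := by
      rcases lt_trichotomy (π (π b)) (π b) with h | h | h
      · have := claimB hv (π b) j h hj (by rw [hb, Fin.lt_def]; omega)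
        rw [hb, Fin.le_def] at this
        omega
      · exact absurd h (tour_ne hn ht _)
      · exact h
    have hbu : b < π b := by
      rcases lt_trichotomy (π b) b with h | h | h
      · have := hv b h hup
        rw [hb] at this
        omega
      · exact absurd h (tour_ne hn ht _)
      · exact h
    have hcl := tour_closed hz (fun k => k < π j) ⟨0, by omega⟩
      (by rw [Fin.lt_def]; exact Nat.pos_of_ne_zero h0) (by
      intro k hk
      by_contra hge
      have hge' := Fin.le_def.1 (not_lt.1 hge)
      have hk' := Fin.lt_def.1 hk
      have hkj : z k ≠ π j := by
        rw [← hzj]; intro e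
        have := z.injective e
        subst this
        omega
      have hkj' : z k ≠ z (π j) := by
        intro e
        have := z.injective e
        subst this
        omega
      have v1 : (z k : ℕ) ≠ π j := fun e => hkj (Fin.ext e)
      have v2 : (z k : ℕ) ≠ z (π j) := fun e => hkj' (Fin.ext e)
      rcases hs k with h | h
      · have h3 := claimA hv _ b rfl hbu k (by rw [← h, Fin.lt_def]; omega)
          (by rw [hb, Fin.lt_def]; omega)
        rw [hb, ← h, Fin.le_def] at h3
        omega
      · have h4 := rot_val k
        rw [← h] at h4
        split_ifs at h4 <;> omega) (π j)
    exact lt_irrefl _ hcl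
  let t : Fin n := ⟨n - 1, by omega⟩
  have htv : (t : ℕ) = n - 1 := rfl
  rcases hs t with htop | htop
  · left
    have desc : ∀ N, ∀ j : Fin n, n - (j : ℕ) = N → π j < j → z j = π j := by
      intro N
      induction N using Nat.strong_induction_on with
      | _ N ih =>
      intro j hN hj
      by_cases hjt : j = t
      · rw [hjt, htop]
      obtain ⟨i, rfl⟩ := π.surjective j
      rcases lt_trichotomy (π i) i with h | h | h
      · have := ih _ (by rw [← hN]; have := Fin.lt_def.1 h; omega) i rfl h
        refine (star i h this ?_).2
        have := Fin.lt_def.1 hj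
        omega
      · exact absurd h (tour_ne hn ht _)
      · exact absurd (Fin.ext (by have := onePeak ht hv i h hj; omega)) hjt
    ext1 a
    rcases lt_trichotomy (π a) a with h | h | h
    · exact desc _ a rfl h
    · exact absurd h (tour_ne hn ht _)
    · rcases hs a with h1 | h1
      · exact h1
      by_contra hne
      have hr := rot_val a
      have hl := (π a).isLt
      have hh := Fin.lt_def.1 h
      rw [if_neg (by omega), ← h1] at hr
      have hne' : (z a : ℕ) ≠ π a := fun e => hne (Fin.ext e)
      obtain ⟨b, hb⟩ := π.surjective (z a)
      rcases lt_trichotomy (π b) b with g | g | g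
      · have := desc _ b rfl g
        rw [hb] at this
        have := z.injective this
        subst this
        have := Fin.lt_def.1 g
        omega
      · exact absurd g (tour_ne hn ht _)
      · have := claimA hv _ b rfl g a h (by rw [hb, Fin.lt_def]; omega)
        rw [hb, Fin.le_def] at this
        omega
  · right
    have hr := rot_val t
    rw [if_pos (by omega), ← htop] at hr
    have desc : ∀ N, ∀ j : Fin n, (j : ℕ) = N → j ≠ t → π j < j → z j ≠ π j := by
      intro N
      induction N using Nat.strong_induction_on with
      | _ N ih =>
      intro j hN hjt hj hzj
      have hj' := Fin.lt_def.1 hj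
      by_cases h0 : (π j : ℕ) = 0
      · exact hjt (z.injective (Fin.ext (by rw [hzj, h0, hr])))
      · obtain ⟨g1, g2⟩ := star j hj hzj h0
        refine ih _ (by omega) (π j) rfl ?_ g1 g2
        intro e
        have := Fin.ext_iff.1 e
        omega
    ext1 a
    by_cases hat : a = t
    · rw [hat, htop]
    rcases lt_trichotomy (π a) a with h | h | h
    · exact (hs a).resolve_left (desc _ a rfl hat h)
    · exact absurd h (tour_ne hn ht _)
    · rcases hs a with h1 | h1
      · by_contra hne
        have hl := (π a).isLt
        have hh := Fin.lt_def.1 h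
        have hra := rot_val a
        rw [if_neg (by omega)] at hra
        have hne' : (π a : ℕ) ≠ a + 1 := fun e => hne (by rw [h1]; exact Fin.ext (by omega))
        let c : Fin n := ⟨(π a : ℕ) - 1, by omega⟩
        have hcv : (c : ℕ) = (π a : ℕ) - 1 := rfl
        have hct : c ≠ t := fun e => by have := Fin.ext_iff.1 e; omega
        rcases lt_trichotomy (π c) c with g | g | g
        · have h5 := (hs c).resolve_left (desc _ c rfl hct g)
          have hrc := rot_val c
          rw [if_neg (by omega), ← h5] at hrc
          have : z c = z a := by rw [h1]; exact Fin.ext (by omega)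
          have := Fin.ext_iff.1 (z.injective this)
          omega
        · exact absurd g (tour_ne hn ht _)
        · have h6 := claimA hv _ a rfl h c g (by rw [Fin.lt_def]; omega)
          have h6' := Fin.le_def.1 h6
          have g' := Fin.lt_def.1 g
          have : π c = π a := Fin.ext (by omega)
          have := Fin.ext_iff.1 (π.injective this)
          omega
      · exact h1

theorem sb_facts {n : ℕ} {x : Equiv.Perm (Fin n)} {p : Fin n} (h : IsStepBackPeak x p) :
    ∃ q : Fin n, (q : ℕ) + 1 = p ∧ 1 ≤ (q : ℕ) ∧ (p : ℕ) + 1 < n ∧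
      ((x p = q ∧ p < x q ∧ x⁻¹ p < q ∧ x⁻¹ q = p) ∨
        (x⁻¹ p = q ∧ x q = p ∧ x p < q ∧ p < x⁻¹ q)) := by
  rcases h with ⟨h1, h2, h3⟩ | ⟨h1, h2, h3⟩
  · have hl := (x (x p)).isLt
    have h3' := Fin.lt_def.1 h3
    have h1' := Fin.lt_def.1 h1
    have hne : x⁻¹ p ≠ x p := by
      intro e
      rw [Equiv.Perm.inv_eq_iff_eq] at e
      rw [← e] at h3'
      omega
    have hne' : (x⁻¹ p : ℕ) ≠ x p := fun e => hne (Fin.ext e)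
    refine ⟨x p, h2, by omega, by omega, Or.inl ⟨rfl, h3, by rw [Fin.lt_def]; omega, by simp⟩⟩
  · have hl := (x⁻¹ (x⁻¹ p)).isLt
    have h3' := Fin.lt_def.1 h3
    have h1' := Fin.lt_def.1 h1
    have hne : x p ≠ x⁻¹ p := by
      intro e
      rw [← e] at h1'
      simp at h1'
    have hne' : (x p : ℕ) ≠ x⁻¹ p := fun e => hne (Fin.ext e)
    exact ⟨x⁻¹ p, h2, by omega, by omega, Or.inr ⟨rfl, by simp, by rw [Fin.lt_def]; omega, h1⟩⟩

theorem peaks_card {n : ℕ} (x : Equiv.Perm (Fin n)) (hne : ∀ i, x i ≠ i) :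
    (Finset.univ.filter fun i => x⁻¹ i < i ∧ x i < i).card =
      (Finset.univ.filter fun i => i < x⁻¹ i ∧ i < x i).card := by
  classical
  have hne' : ∀ i, x⁻¹ i ≠ i := fun i e => hne i (by rw [Equiv.Perm.inv_eq_iff_eq] at e; exact e.symm)
  have h1 : (Finset.univ.filter fun i => x i < i).card =
      (Finset.univ.filter fun i => i < x⁻¹ i).card := by
    apply Finset.card_bij (fun i _ => x i)
    · intro a ha; simpa using ha
    · intro a _ b _ e; exact x.injective e
    · intro b hb; exact ⟨x⁻¹ b, by simpa using hb, by simp⟩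
  have h2 := Finset.card_filter_add_card_filter_not (s := Finset.univ.filter fun i => x i < i)
    (fun i => x⁻¹ i < i)
  have h3 := Finset.card_filter_add_card_filter_not
    (s := Finset.univ.filter fun i => i < x⁻¹ i) (fun i => i < x i)
  simp only [Finset.filter_filter] at h2 h3
  have h4 : (Finset.univ.filter fun i => x i < i ∧ ¬ x⁻¹ i < i) =
      (Finset.univ.filter fun i => i < x⁻¹ i ∧ ¬ i < x i) := by
    ext i
    have a := hne i
    have b := hne' i
    simp only [Finset.mem_filter, Finset.mem_univ, true_and, not_lt]
    constructor
    · rintro ⟨c, d⟩; exact ⟨lt_of_le_of_ne d b.symm, c.le⟩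
    · rintro ⟨c, d⟩; exact ⟨lt_of_le_of_ne d a, c.le⟩
  have h5 : (Finset.univ.filter fun i => x⁻¹ i < i ∧ x i < i) =
      (Finset.univ.filter fun i => x i < i ∧ x⁻¹ i < i) := by
    ext i; simp [and_comm]
  rw [h4] at h2
  rw [h5]
  omega

theorem valley_of_PSB {n : ℕ} (hn : 3 ≤ n) {x : Equiv.Perm (Fin n)} (hx : IsPSB x)
    (i : Fin n) (h1 : i < x⁻¹ i) (h2 : i < x i) : (i : ℕ) = 0 ∨ SBPeakAt x (i + 1) := by
  classical
  have hc := peaks_card x (tour_ne hn hx.1)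
  set A := (Finset.univ.filter fun i => x⁻¹ i < i ∧ x i < i) with hA
  set B := (Finset.univ.filter fun i => i < x⁻¹ i ∧ i < x i) with hB
  have hne := tour_ne hn hx.1
  have hne' : ∀ i, x⁻¹ i ≠ i := fun i e => hne i (by rw [Equiv.Perm.inv_eq_iff_eq] at e; exact e.symm)
  let g : Fin n → Fin n := fun p => if (p : ℕ) = n - 1 then ⟨0, by omega⟩ else ⟨(p : ℕ) - 1, by omega⟩
  have hsb : ∀ p ∈ A, (p : ℕ) ≠ n - 1 → IsStepBackPeak x p := by
    intro p hp hpn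
    by_contra hcon
    exact hpn ((hx.2 p).1 ⟨(Finset.mem_filter.1 hp).2, hcon⟩)
  have hmap : ∀ p ∈ A, g p ∈ B := by
    intro p hp
    by_cases e : (p : ℕ) = n - 1
    · simp only [g, if_pos e, hB, Finset.mem_filter, Finset.mem_univ, true_and]
      constructor
      · have := hne' ⟨0, by omega⟩
        rw [Fin.lt_def]
        exact Nat.pos_of_ne_zero fun h => this (Fin.ext h)
      · have := hne ⟨0, by omega⟩
        rw [Fin.lt_def]
        exact Nat.pos_of_ne_zero fun h => this (Fin.ext h)
    · obtain ⟨q, q1, q2, q3, q4⟩ := sb_facts (hsb p hp e)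
      have : g p = q := by simp only [g, if_neg e]; exact Fin.ext (by simp; omega)
      rw [this]
      have hqp : q < p := by rw [Fin.lt_def]; omega
      simp only [hB, Finset.mem_filter, Finset.mem_univ, true_and]
      rcases q4 with ⟨a, b, c, d⟩ | ⟨a, b, c, d⟩
      · rw [d]; exact ⟨hqp, hqp.trans b⟩
      · rw [b]; exact ⟨hqp.trans d, hqp⟩
  have hinj : Set.InjOn g A := by
    intro p hp p' hp' e
    have e' := Fin.ext_iff.1 e
    by_cases e1 : (p : ℕ) = n - 1 <;> by_cases e2 : (p' : ℕ) = n - 1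
    · exact Fin.ext (by omega)
    · obtain ⟨q, q1, q2, q3, q4⟩ := sb_facts (hsb p' hp' e2)
      simp only [g, if_pos e1, if_neg e2] at e'
      omega
    · obtain ⟨q, q1, q2, q3, q4⟩ := sb_facts (hsb p hp e1)
      simp only [g, if_pos e2, if_neg e1] at e'
      omega
    · obtain ⟨q, q1, q2, q3, q4⟩ := sb_facts (hsb p hp e1)
      obtain ⟨q', q1', q2', q3', q4'⟩ := sb_facts (hsb p' hp' e2)
      simp only [g, if_neg e2, if_neg e1] at e'
      exact Fin.ext (by omega)
  have himg : A.image g = B := by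
    apply Finset.eq_of_subset_of_card_le
    · intro v hv
      obtain ⟨p, hp, rfl⟩ := Finset.mem_image.1 hv
      exact hmap p hp
    · rw [Finset.card_image_of_injOn hinj, hc]
  have hi : i ∈ B := Finset.mem_filter.2 ⟨Finset.mem_univ _, h1, h2⟩
  rw [← himg] at hi
  obtain ⟨p, hp, hpi⟩ := Finset.mem_image.1 hi
  rw [← hpi]
  by_cases e : (p : ℕ) = n - 1
  · left; simp [g, e]
  · right
    obtain ⟨q, q1, q2, q3, q4⟩ := sb_facts (hsb p hp e)
    refine ⟨p, ?_, hsb p hp e⟩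
    simp only [g, if_neg e]
    omega

/-! ### The swapping involution -/

/-- A set of marks suitable as step-back peaks. -/
def Good (n : ℕ) (P : ℕ → Prop) : Prop :=
  ∀ p, P p → 2 ≤ p ∧ p + 1 < n ∧ ¬ P (p + 1)

theorem good_of_PSB {n : ℕ} {x : Equiv.Perm (Fin n)} : Good n (SBPeakAt x) := by
  rintro _ ⟨p, rfl, hp⟩
  obtain ⟨q, q1, q2, q3, q4⟩ := sb_facts hp
  refine ⟨by omega, by omega, ?_⟩
  rintro ⟨r, hr, hr'⟩
  obtain ⟨s, s1, s2, s3, s4⟩ := sb_facts hr'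
  obtain rfl : s = p := Fin.ext (by omega)
  rcases q4 with ⟨a, b, c, d⟩ | ⟨a, b, c, d⟩ <;> rcases s4 with ⟨a', b', c', d'⟩ | ⟨a', b', c', d'⟩
  all_goals simp only [Fin.lt_def, Fin.ext_iff] at *; omega

open Classical in
noncomputable def swapFun {n : ℕ} (P : ℕ → Prop) (hP : Good n P) (i : Fin n) : Fin n :=
  if P i then ⟨(i : ℕ) - 1, by omega⟩
  else if h : P (i + 1) then ⟨(i : ℕ) + 1, by have := hP _ h; omega⟩ else i

theorem swapFun_invol {n : ℕ} (P : ℕ → Prop) (hP : Good n P) :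
    Function.Involutive (swapFun P hP) := by
  intro i
  by_cases h1 : P i
  · have h2 := hP _ h1
    have h3 : ¬ P ((i : ℕ) - 1) := fun h => (hP _ h).2.2 (by
      rwa [Nat.sub_add_cancel (by omega)])
    have h4 : P ((i : ℕ) - 1 + 1) := by rwa [Nat.sub_add_cancel (by omega)]
    apply Fin.ext
    simp [swapFun, h1, h3, h4]
    omega
  · by_cases h2 : P (i + 1)
    · simp [swapFun, h1, h2]
    · simp [swapFun, h1, h2]

noncomputable def swp {n : ℕ} (P : ℕ → Prop) (hP : Good n P) : Equiv.Perm (Fin n) :=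
  (swapFun_invol P hP).toPerm

theorem swp_mul {n : ℕ} (P : ℕ → Prop) (hP : Good n P) : swp P hP * swp P hP = 1 := by
  ext1 i
  exact swapFun_invol P hP i

theorem swp_swp {n : ℕ} (P : ℕ → Prop) (hP : Good n P) (i : Fin n) :
    swp P hP (swp P hP i) = i := swapFun_invol P hP i

/-- Value of the involution, as a disjunction. -/
theorem swp_val {n : ℕ} (P : ℕ → Prop) (hP : Good n P) (i : Fin n) :
    (P i ∧ ¬ P (i + 1) ∧ 2 ≤ (i : ℕ) ∧ (i : ℕ) + 1 < n ∧ (swp P hP i : ℕ) + 1 = i) ∨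
    (¬ P i ∧ P (i + 1) ∧ 1 ≤ (i : ℕ) ∧ (i : ℕ) + 2 < n ∧ (swp P hP i : ℕ) = i + 1) ∨
    (¬ P i ∧ ¬ P (i + 1) ∧ (swp P hP i : ℕ) = i) := by
  have e : swp P hP i = swapFun P hP i := rfl
  rw [e]
  by_cases h1 : P i
  · have h2 := hP _ h1
    left
    simp [swapFun, h1, h2]
    omega
  · by_cases h2 : P (i + 1)
    · have h3 := hP _ h2
      right; left
      simp [swapFun, h1, h2]
      omega
    · simp [swapFun, h1, h2]

/-- The involution preserves order except on swapped pairs. -/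
theorem swp_lt {n : ℕ} (P : ℕ → Prop) (hP : Good n P) (i j : Fin n)
    (h : swp P hP i < swp P hP j) : (i < j ∧ ¬ ((i : ℕ) + 1 = j ∧ P j)) ∨
      ((j : ℕ) + 1 = i ∧ P i) := by
  have a := swp_val P hP i
  have b := swp_val P hP j
  simp only [Fin.lt_def] at *
  rcases lt_trichotomy (i : ℕ) j with c | c | c
  · left
    refine ⟨c, ?_⟩
    rintro ⟨d, e⟩
    rw [d] at a
    rcases a with a | a | a <;> rcases b with b | b | b <;> first | omega | tauto
  · rw [Fin.ext c] at h; omega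
  · by_cases d : (j : ℕ) + 1 = i
    · rw [d] at b
      rcases a with a | a | a <;> rcases b with b | b | b <;> first | omega | tauto
    · exfalso
      rcases a with a | a | a <;> rcases b with b | b | b <;> omega

theorem oneValley_conj {n : ℕ} (hn : 3 ≤ n) {x : Equiv.Perm (Fin n)} (hx : IsPSB x)
    (hP : Good n (SBPeakAt x)) :
    OneValley (swp (SBPeakAt x) hP * x * swp (SBPeakAt x) hP) := by
  intro h h1 h2
  obtain ⟨k, rfl⟩ := (swp (SBPeakAt x) hP).surjective h
  simp only [Equiv.Perm.mul_apply, swp_swp] at *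
  have hk : x⁻¹ (x k) = k := by simp
  generalize x k = j at *
  have hne := tour_ne hn hx.1 j
  have a := swp_lt _ hP _ _ h1
  have b := swp_lt _ hP _ _ h2
  have key : ∀ p : Fin n, SBPeakAt x p → IsStepBackPeak x p := by
    rintro p ⟨q, hq, hq'⟩
    rwa [← Fin.ext hq]
  rcases a with ⟨a1, a2⟩ | ⟨a1, a2⟩
  · rcases b with ⟨b1, b2⟩ | ⟨b1, b2⟩
    · rcases valley_of_PSB hn hx j (by rw [hk]; exact a1) b1 with h0 | ⟨p, hp1, hp2⟩
      · have := swp_val _ hP j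
        omega
      · exfalso
        obtain ⟨q, q1, q2, q3, q4⟩ := sb_facts hp2
        obtain rfl : q = j := Fin.ext (by omega)
        rcases q4 with ⟨a, b, c, d⟩ | ⟨a, b, c, d⟩
        · obtain rfl : k = p := by rw [← hk]; exact d
          exact a2 ⟨q1, ⟨k, rfl, hp2⟩⟩
        · rw [b] at b2
          exact b2 ⟨q1, ⟨p, rfl, hp2⟩⟩
    · exfalso
      obtain ⟨q, q1, q2, q3, q4⟩ := sb_facts (key _ b2)
      rw [hk] at q4
      simp only [Fin.lt_def, Fin.ext_iff] at *
      omega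
  · exfalso
    obtain ⟨q, q1, q2, q3, q4⟩ := sb_facts (key _ a2)
    rw [hk] at q4
    obtain rfl : k = q := Fin.ext (by omega)
    simp only [Fin.lt_def, Fin.ext_iff] at *
    omega

/-- The all-ascending tour with step-back marks `P`. -/
noncomputable def asc {n : ℕ} (P : ℕ → Prop) (hP : Good n P) : Equiv.Perm (Fin n) :=
  swp P hP * finRotate n * swp P hP

theorem asc_val {n : ℕ} (P : ℕ → Prop) (hP : Good n P) (i : Fin n) :
    (P i ∧ (asc P hP i : ℕ) + 1 = i) ∨
    ((i : ℕ) + 1 = n ∧ (asc P hP i : ℕ) = 0) ∨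
    (¬ P i ∧ (i : ℕ) + 1 < n ∧ P (i + 1) ∧
      ((asc P hP i : ℕ) = i + 2 ∨ ((asc P hP i : ℕ) = i + 3 ∧ P (i + 3)))) ∨
    (¬ P i ∧ (i : ℕ) + 1 < n ∧ ¬ P (i + 1) ∧
      ((asc P hP i : ℕ) = i + 1 ∨ ((asc P hP i : ℕ) = i + 2 ∧ P (i + 2)))) := by
  simp only [asc, Equiv.Perm.mul_apply]
  have h1 := swp_val P hP i
  have h2 := rot_val (swp P hP i)
  have h3 := swp_val P hP (finRotate n (swp P hP i))
  generalize (swp P hP) (finRotate n (swp P hP i)) = c at *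
  generalize finRotate n (swp P hP i) = b at *
  generalize swp P hP i = a at *
  have hi := i.isLt
  have hnP : P i → ¬ P (i + 1) := fun h => (hP _ h).2.2
  rcases h1 with ⟨g1, g2, g3, g4, g5⟩ | ⟨g1, g2, g3, g4, g5⟩ | ⟨g1, g2, g3⟩
  · rw [if_neg (by omega)] at h2
    have hb : (b : ℕ) = i := by omega
    rw [hb] at h3
    left
    refine ⟨g1, ?_⟩
    rcases h3 with h | h | h
    · omega
    · exact absurd h.2.1 g2
    · exact absurd g1 h.1
  · rw [if_neg (by omega)] at h2
    have hb : (b : ℕ) = i + 2 := by omega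
    rw [hb] at h3
    right; right; left
    refine ⟨g1, by omega, g2, ?_⟩
    rcases h3 with h | h | h
    · exact absurd h.1 (hP _ g2).2.2
    · right; exact ⟨by omega, h.2.1⟩
    · left; omega
  · by_cases hl : (i : ℕ) + 1 = n
    · rw [if_pos (by omega)] at h2
      right; left
      omega
    · rw [if_neg (by omega)] at h2
      have hb : (b : ℕ) = i + 1 := by omega
      rw [hb] at h3
      right; right; right
      refine ⟨g1, by omega, g2, ?_⟩
      rcases h3 with h | h | h
      · exact absurd h.1 g2
      · right; exact ⟨by omega, h.2.1⟩
      · left; omega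

theorem asc_PSB {n : ℕ} (hn : 3 ≤ n) (P : ℕ → Prop) (hP : Good n P) : IsPSB (asc P hP) := by
  have ht : IsTour (asc P hP) := tour_conj (rot_tour hn) (swp_mul P hP)
  refine ⟨ht, fun i => ⟨?_, ?_⟩⟩
  · rintro ⟨⟨h1, h2⟩, h3⟩
    have h1' := Fin.lt_def.1 h1
    have h2' := Fin.lt_def.1 h2
    by_contra hi
    have a := asc_val P hP i
    have hlt := i.isLt
    have hPi : P i ∧ (asc P hP i : ℕ) + 1 = i := by
      rcases a with a | a | a | a
      · exact a
      all_goals omega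
    apply h3
    left
    refine ⟨h1, hPi.2, ?_⟩
    have b := asc_val P hP (asc P hP i)
    have g := hP _ hPi.1
    have e : P ((asc P hP i : ℕ) + 1) := by rw [hPi.2]; exact hPi.1
    rw [Fin.lt_def]
    rcases b with b | b | b | b
    · exact absurd e (hP _ b.1).2.2
    · omega
    · omega
    · exact absurd e b.2.2.1
  · intro hi
    have hmax : ∀ j : Fin n, ¬ i < j := by
      intro j hj
      have := Fin.lt_def.1 hj
      omega
    refine ⟨⟨?_, ?_⟩, ?_⟩
    · refine lt_of_le_of_ne (not_lt.1 (hmax _)) fun e => ?_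
      rw [Equiv.Perm.inv_eq_iff_eq] at e
      exact tour_ne hn ht i e.symm
    · exact lt_of_le_of_ne (not_lt.1 (hmax _)) (tour_ne hn ht i)
    · rintro (h | h)
      · exact hmax _ h.2.2
      · exact hmax _ h.1

theorem rotInv_val {n : ℕ} (i : Fin n) :
    ((i : ℕ) = 0 ∧ ((finRotate n)⁻¹ i : ℕ) + 1 = n) ∨ ((finRotate n)⁻¹ i : ℕ) + 1 = i := by
  have h := rot_val ((finRotate n)⁻¹ i)
  have e : finRotate n ((finRotate n)⁻¹ i) = i := (finRotate n).apply_symm_apply i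
  rw [e] at h
  split_ifs at h <;> omega

theorem rev_PSB {n : ℕ} (hn : 3 ≤ n) : IsPSB (finRotate n)⁻¹ := by
  have ht : IsTour (finRotate n)⁻¹ := tour_inv (rot_tour hn)
  refine ⟨ht, fun i => ⟨?_, ?_⟩⟩
  · rintro ⟨⟨h1, h2⟩, h3⟩
    rw [inv_inv] at h1
    have h1' := Fin.lt_def.1 h1
    have := rot_val i
    split_ifs at this <;> omega
  · intro hi
    have hmax : ∀ j : Fin n, ¬ i < j := by
      intro j hj
      have := Fin.lt_def.1 hj
      omega
    refine ⟨⟨?_, ?_⟩, ?_⟩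
    · refine lt_of_le_of_ne (not_lt.1 (hmax _)) fun e => ?_
      rw [Equiv.Perm.inv_eq_iff_eq] at e
      exact tour_ne hn ht i e.symm
    · exact lt_of_le_of_ne (not_lt.1 (hmax _)) (tour_ne hn ht i)
    · rintro (h | h)
      · exact hmax _ h.2.2
      · exact hmax _ h.1

theorem conj_cancel {n : ℕ} {s : Equiv.Perm (Fin n)} (hs : s * s = 1) (y : Equiv.Perm (Fin n)) :
    s * (s * y * s) * s = y := by
  calc s * (s * y * s) * s = (s * s) * y * (s * s) := by simp only [mul_assoc]
    _ = y := by rw [hs]; simp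

theorem step1 {n : ℕ} (hn : 3 ≤ n) {x : Equiv.Perm (Fin n)} (hx : IsPSB x) :
    chv x = chv (asc (SBPeakAt x) good_of_PSB) ∨
      AdjacentIn (PSBvertices n) (chv x) (chv (asc (SBPeakAt x) good_of_PSB)) := by
  apply adj_of hx (asc_PSB hn _ _)
  intro z hz hs
  have hP : Good n (SBPeakAt x) := good_of_PSB
  set s := swp (SBPeakAt x) hP with hsdef
  have hss : s * s = 1 := swp_mul _ _
  have hsi : ∀ i, s (s i) = i := swp_swp _ _
  have := core hn (π := s * x * s) (z := s * z * s) (tour_conj hx.1 hss)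
    (oneValley_conj hn hx hP) (tour_conj hz hss) (by
      intro i
      simp only [Equiv.Perm.mul_apply]
      rcases hs (s i) with h | h
      · left; rw [h]
      · right; rw [h]
        change s ((s * finRotate n * s) (s i)) = _
        simp only [Equiv.Perm.mul_apply, hsi])
  rcases this with h | h
  · left
    rw [← conj_cancel hss z, h, conj_cancel hss x]
  · right
    rw [← conj_cancel hss z, h]
    rfl

theorem step2 {n : ℕ} (hn : 3 ≤ n) (P : ℕ → Prop) (hP : Good n P) (z : Equiv.Perm (Fin n))
    (hz : IsTour z) (hs : ∀ i, z i = asc P hP i ∨ z i = (finRotate n)⁻¹ i) :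
    z = asc P hP ∨ z = (finRotate n)⁻¹ := by
  let t : Fin n := ⟨n - 1, by omega⟩
  have htv : (t : ℕ) = n - 1 := rfl
  rcases hs t with htop | htop
  · left
    have hz0 : (z t : ℕ) = 0 := by
      have h := asc_val P hP t
      rw [← htop] at h
      rcases h with h | h | h | h
      · have := hP _ h.1; omega
      all_goals omega
    have main : ∀ N, ∀ j : Fin n, (j : ℕ) = N → z j = asc P hP j := by
      intro N
      induction N using Nat.strong_induction_on with
      | _ N ih =>
      intro j hN
      by_contra hne
      have hjt : (j : ℕ) ≠ n - 1 := by
        intro e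
        exact hne (by rw [show j = t from Fin.ext e]; exact htop)
      have hrv := rotInv_val j
      have hzj := (hs j).resolve_left hne
      rw [← hzj] at hrv
      rcases hrv with ⟨h0, h1⟩ | h1
      · have : z j = t := Fin.ext (by omega)
        exact tour_ne2 hn hz j (by rw [this]; exact Fin.ext (by omega))
      have hPj : ¬ P j := by
        intro h
        rcases asc_val P hP j with g | g | g | g
        · exact hne (Fin.ext (by omega))
        · omega
        · exact g.1 h
        · exact g.1 h
      -- values of `z` on step-back peaks
      have hzP : ∀ p : Fin n, P p → (z p : ℕ) + 1 = p := by
        intro p hp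
        have h2 := hP _ hp
        rcases hs p with h | h
        · rw [h]
          rcases asc_val P hP p with g | g | g | g
          · exact g.2
          · omega
          · exact absurd hp g.1
          · exact absurd hp g.1
        · rw [h]
          have := rotInv_val p
          omega
      have hS : ∃ S : Fin n → Prop, S j ∧ (∀ k, S k → S (z k)) ∧ ¬ S t := by
        -- the block just below `j`
        have hcl : ∀ m : Fin n, ((m : ℕ) = j ∨ ((m : ℕ) = j + 1 ∧ P m)) →
            (z (z j) = m ∨ ((z (z j) : ℕ) + 2 = j ∧ z (z (z j)) = m)) →
            ∃ S : Fin n → Prop, S j ∧ (∀ k, S k → S (z k)) ∧ ¬ S t := by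
          intro m hm hm2
          have hzm : m = j ∨ z m = j := by
            rcases hm with hm | hm
            · left; exact Fin.ext hm
            · right
              have := hzP m hm.2
              exact Fin.ext (by omega)
          have hmt : m ≠ t := by
            rintro rfl
            rcases hm with hm | hm
            · omega
            · have := hP _ hm.2
              omega
          refine ⟨fun k => k = j ∨ k = z j ∨ k = m ∨ (k = z (z j) ∧ (k : ℕ) + 2 = j), Or.inl rfl,
            ?_, ?_⟩
          · rintro k (rfl | rfl | rfl | ⟨rfl, hk⟩)
            · right; left; rfl
            · rcases hm2 with h | h
              · right; right; left; exact h
              · right; right; right; exact ⟨rfl, h.1⟩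
            · rcases hzm with h | h
              · right; left; rw [h]
              · left; exact h
            · rcases hm2 with h | h
              · rcases hm with e | e <;> rw [h] at hk <;> omega
              · right; right; left; exact h.2
          · rintro (h | h | h | ⟨h, hk⟩)
            · exact hjt (Fin.ext_iff.1 h ▸ rfl)
            · have := Fin.ext_iff.1 h; omega
            · exact hmt h.symm
            · omega
        have i1 := ih _ (by omega) (z j) rfl
        rcases asc_val P hP (z j) with g | g | g | g
        · -- `j - 1` is a step-back peak
          rw [← i1] at g
          have i2 := ih _ (by omega) (z (z j)) rfl
          have gg := hP _ g.1
          have e1 : (z (z j) : ℕ) + 1 = z j := g.2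
          rcases asc_val P hP (z (z j)) with k | k | k | k
          · have := (hP _ k.1).2.2
            rw [e1] at this
            exact absurd g.1 this
          · omega
          · rw [← i2] at k
            rcases k.2.2.2 with l | l
            · exact hcl (z (z (z j))) (Or.inl (by omega)) (Or.inr ⟨by omega, rfl⟩)
            · refine hcl (z (z (z j))) (Or.inr ⟨by omega, ?_⟩) (Or.inr ⟨by omega, rfl⟩)
              rw [l.1]; exact l.2
          · rw [e1] at k
            exact absurd g.1 k.2.2.1
        · omega
        · rw [h1] at g
          exact absurd g.2.2.1 hPj
        · rw [← i1] at g
          rcases g.2.2.2 with l | l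
          · exact hcl (z (z j)) (Or.inl (by omega)) (Or.inl rfl)
          · refine hcl (z (z j)) (Or.inr ⟨by omega, ?_⟩) (Or.inl rfl)
            rw [l.1]; exact l.2
      obtain ⟨S, s1, s2, s3⟩ := hS
      exact s3 (tour_closed hz S j s1 s2 t)
    ext1 j
    exact main _ j rfl
  · right
    have main : ∀ N, ∀ j : Fin n, n - (j : ℕ) = N → 1 ≤ (j : ℕ) → (z j : ℕ) + 1 = j := by
      intro N
      induction N using Nat.strong_induction_on with
      | _ N ih =>
      intro j hN hj
      by_contra hne
      have hzj : z j = asc P hP j := by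
        refine (hs j).resolve_right fun h => ?_
        have := rotInv_val j
        rw [← h] at this
        omega
      have hjt : (j : ℕ) + 1 ≠ n := by
        intro e
        have hj : j = t := Fin.ext (by omega)
        have := rotInv_val j
        rw [hj, ← htop, ← hj] at this
        omega
      have hgt : (j : ℕ) < z j := by
        have := asc_val P hP j
        rw [← hzj] at this
        omega
      have := tour_closed hz (fun k => j ≤ k ∧ k ≤ z j) j ⟨le_rfl, by rw [Fin.le_def]; omega⟩ (by
        rintro k ⟨k1, k2⟩
        rcases eq_or_lt_of_le k1 with e | e
        · rw [← e]; exact ⟨by rw [Fin.le_def]; omega, le_rfl⟩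
        · simp only [Fin.lt_def, Fin.le_def] at *
          have := ih (n - (k : ℕ)) (by omega) k rfl (by omega)
          omega) ⟨0, by omega⟩
      have := Fin.le_def.1 this.1
      simp at this
      omega
    ext1 j
    have hr := rotInv_val j
    by_cases h0 : (j : ℕ) = 0
    · rcases hs j with h | h
      · by_contra hne
        have hlt := (z j).isLt
        by_cases e : (z j : ℕ) + 1 = n
        · exact hne (Fin.ext (by omega))
        · let k : Fin n := ⟨(z j : ℕ) + 1, by omega⟩
          have hk : (k : ℕ) = (z j : ℕ) + 1 := rfl
          have h1 := main _ k rfl (by omega)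
          have h2 : z k = z j := Fin.ext (by omega)
          have := Fin.ext_iff.1 (z.injective h2)
          omega
      · exact h
    · have := main _ j rfl (by omega)
      exact Fin.ext (by omega)

theorem adj_symm {n : ℕ} {u w : Fin n × Fin n → ℝ}
    (h : u = w ∨ AdjacentIn (PSBvertices n) u w) : w = u ∨ AdjacentIn (PSBvertices n) w u := by
  rcases h with h | ⟨h1, h2⟩
  · exact Or.inl h.symm
  · exact Or.inr ⟨h1.symm, by rw [segment_symm]; exact h2⟩

/-- The diameter of the 1-skeleton of `PSB(n)` is at most 4: any two vertices are
joined by a walk of four steps, each step staying in place or crossing an edge. -/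
theorem stmt8 (n : ℕ) (hn : 3 ≤ n) :
    ∀ u ∈ PSBvertices n, ∀ w ∈ PSBvertices n,
      ∃ p : ℕ → (Fin n × Fin n → ℝ), p 0 = u ∧ p 4 = w ∧
        (∀ i ≤ 4, p i ∈ PSBvertices n) ∧
        (∀ i < 4, p i = p (i + 1) ∨ AdjacentIn (PSBvertices n) (p i) (p (i + 1))) := by
  rintro _ ⟨x, hx, rfl⟩ _ ⟨y, hy, rfl⟩
  have hx1 := asc_PSB hn (SBPeakAt x) good_of_PSB
  have hy1 := asc_PSB hn (SBPeakAt y) good_of_PSB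
  have hr := rev_PSB hn
  let p : ℕ → (Fin n × Fin n → ℝ) := fun i => match i with
    | 0 => chv x
    | 1 => chv (asc (SBPeakAt x) good_of_PSB)
    | 2 => chv (finRotate n)⁻¹
    | 3 => chv (asc (SBPeakAt y) good_of_PSB)
    | _ => chv y
  refine ⟨p, rfl, rfl, ?_, ?_⟩
  · intro i hi
    interval_cases i
    · exact ⟨x, hx, rfl⟩
    · exact ⟨_, hx1, rfl⟩
    · exact ⟨_, hr, rfl⟩
    · exact ⟨_, hy1, rfl⟩
    · exact ⟨y, hy, rfl⟩
  · intro i hi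
    interval_cases i
    · exact step1 hn hx
    · exact adj_of hx1 hr (step2 hn _ _)
    · exact adj_symm (adj_of hy1 hr (step2 hn _ _))
    · exact adj_symm (step1 hn hy)
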